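/- arXiv:1707.07288 — 2 statements merged into one kernel-verified Lean document; each statement's English description precedes it below -/
import Mathlib

section
/- Every 2-extendable non-bipartite finite simple graph on 6 vertices has at least 15 edges (i.e., is the complete graph K_6), and K_6 is a 2-extendable non-bipartite graph on 6 vertices with exactly 15 edges; hence ε(6,2) = 15. -/
open SimpleGraph

/-- `G` is `n`-factor-critical if for every set `S` of exactly `n` vertices,
the graph obtained by deleting `S` has a perfect matching; formalized as:
there is a matching of `G` whose vertex set is exactly the complement of `S`. -/
def IsFactorCritical {V : Type*} (G : SimpleGraph V) (n : ℕ) : Prop :=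
  ∀ S : Finset V, S.card = n →
    ∃ M : G.Subgraph, M.IsMatching ∧ M.verts = (↑S : Set V)ᶜ

/-- `G` is `k`-extendable if it is connected, has a matching with `k` edges,
and every matching with `k` edges is contained in a perfect matching. -/
def IsExtendable {V : Type*} (G : SimpleGraph V) (k : ℕ) : Prop :=
  G.Connected ∧
  (∃ M : G.Subgraph, M.IsMatching ∧ M.edgeSet.ncard = k) ∧
  ∀ M : G.Subgraph, M.IsMatching → M.edgeSet.ncard = k →
    ∃ P : G.Subgraph, P.IsPerfectMatching ∧ M ≤ P

namespace SimpleGraph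

variable {V : Type*} {G : SimpleGraph V}

/-- Two disjoint edges form a matching. -/
theorem isMatching_subgraphOfAdj_sup {a b c d : V} (hab : G.Adj a b) (hcd : G.Adj c d)
    (hac : a ≠ c) (had : a ≠ d) (hbc : b ≠ c) (hbd : b ≠ d) :
    (G.subgraphOfAdj hab ⊔ G.subgraphOfAdj hcd).IsMatching := by
  refine (Subgraph.IsMatching.subgraphOfAdj hab).sup (Subgraph.IsMatching.subgraphOfAdj hcd) ?_
  rw [support_subgraphOfAdj, support_subgraphOfAdj]
  simp [hac.symm, had.symm, hbc.symm, hbd.symm]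

theorem ncard_edgeSet_subgraphOfAdj_sup {a b c d : V} (hab : G.Adj a b) (hcd : G.Adj c d)
    (hac : a ≠ c) (had : a ≠ d) :
    (G.subgraphOfAdj hab ⊔ G.subgraphOfAdj hcd).edgeSet.ncard = 2 := by
  rw [Subgraph.edgeSet_sup, edgeSet_subgraphOfAdj, edgeSet_subgraphOfAdj, Set.singleton_union]
  exact Set.ncard_pair (by simp [hac, had])

theorem Subgraph.IsMatching.exists_eq_sup_of_ncard_eq_two {M : G.Subgraph} (hM : M.IsMatching)
    (h2 : M.edgeSet.ncard = 2) :
    ∃ (a b c d : V) (hab : G.Adj a b) (hcd : G.Adj c d), [a, b, c, d].Nodup ∧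
      M = G.subgraphOfAdj hab ⊔ G.subgraphOfAdj hcd := by
  obtain ⟨x, y, hxy, hE⟩ := Set.ncard_eq_two.mp h2
  induction x with | h a b
  induction y with | h c d
  have key : ∀ v w, M.Adj v w ↔ s(v, w) = s(a, b) ∨ s(v, w) = s(c, d) := fun v w => by
    rw [← Subgraph.mem_edgeSet, hE]; simp
  have hab : M.Adj a b := (key a b).2 (Or.inl rfl)
  have hcd : M.Adj c d := (key c d).2 (Or.inr rfl)
  have uniq : ∀ {v w w'}, M.Adj v w → M.Adj v w' → w = w' := fun h h' => hM.eq_of_adj_left h h'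
  refine ⟨a, b, c, d, hab.adj_sub, hcd.adj_sub, ?_, ?_⟩
  · have h1 := hab.adj_sub.ne
    have h2 := hcd.adj_sub.ne
    have h3 : a ≠ c := by rintro rfl; exact hxy (by rw [uniq hab hcd])
    have h4 : a ≠ d := by rintro rfl; exact hxy (by rw [uniq hab hcd.symm, Sym2.eq_swap])
    have h5 : b ≠ c := by rintro rfl; exact hxy (by rw [uniq hab.symm hcd, Sym2.eq_swap])
    have h6 : b ≠ d := by rintro rfl; exact hxy (by rw [uniq hab.symm hcd.symm])
    simp [*]
  · ext v w
    · simp only [Subgraph.verts_sup, subgraphOfAdj_verts, Set.mem_union, Set.mem_insert_iff,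
        Set.mem_singleton_iff]
      constructor
      · intro hv
        obtain ⟨w, hw, -⟩ := hM hv
        rw [key] at hw
        simp only [Sym2.eq_iff] at hw
        tauto
      · rintro ((rfl | rfl) | rfl | rfl)
        exacts [hab.fst_mem, hab.snd_mem, hcd.fst_mem, hcd.snd_mem]
    · rw [key]
      simp [eq_comm]

theorem exists_pair_of_nodup_of_card_eq_six [Fintype V] (hV : Fintype.card V = 6) {a b c d : V}
    (h : [a, b, c, d].Nodup) :
    ∃ e f : V, [a, b, c, d, e, f].Nodup ∧ ∀ v, v ∈ [a, b, c, d, e, f] := by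
  classical
  have h4 : ([a, b, c, d].toFinset)ᶜ.card = 2 := by
    rw [Finset.card_compl, List.toFinset_card_of_nodup h, hV]; rfl
  obtain ⟨e, f, hef, hS⟩ := Finset.card_eq_two.mp h4
  refine ⟨e, f, ?_, fun v => ?_⟩
  · have he : e ∉ [a, b, c, d] := by rw [← List.mem_toFinset, ← Finset.mem_compl, hS]; simp
    have hf : f ∉ [a, b, c, d] := by rw [← List.mem_toFinset, ← Finset.mem_compl, hS]; simp
    simp only [List.nodup_cons, List.mem_cons, List.not_mem_nil, or_false, not_or] at h he hf ⊢
    grind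
  · have := Finset.ext_iff.1 hS v
    simp only [Finset.mem_compl, List.mem_toFinset, Finset.mem_insert, Finset.mem_singleton,
      List.mem_cons, List.not_mem_nil, or_false] at this ⊢
    tauto

theorem _root_.List.Nodup.mem_of_length_eq_card [Fintype V] {l : List V} (hl : l.Nodup)
    (h : l.length = Fintype.card V) (v : V) : v ∈ l := by
  classical
  rw [← List.mem_toFinset, Finset.eq_univ_of_card _ ((List.toFinset_card_of_nodup hl).trans h)]
  exact Finset.mem_univ v

/-- In a 2-extendable graph on six vertices, two of the edges of a partition of the vertices into
pairs force the third. -/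
theorem adj_of_isExtendable_two (hG : IsExtendable G 2) {a b c d e f : V}
    (hn : [a, b, c, d, e, f].Nodup) (hc : ∀ v, v ∈ [a, b, c, d, e, f])
    (hab : G.Adj a b) (hcd : G.Adj c d) : G.Adj e f := by
  simp only [List.nodup_cons, List.mem_cons, List.not_mem_nil, or_false, not_or] at hn hc
  obtain ⟨P, ⟨hP, hs⟩, hle⟩ := hG.2.2 (G.subgraphOfAdj hab ⊔ G.subgraphOfAdj hcd)
    (isMatching_subgraphOfAdj_sup hab hcd (by tauto) (by tauto) (by tauto) (by tauto))
    (ncard_edgeSet_subgraphOfAdj_sup hab hcd (by tauto) (by tauto))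
  have pab : P.Adj a b := hle.2 (by simp)
  have pcd : P.Adj c d := hle.2 (by simp)
  obtain ⟨w, hw, -⟩ := hP (hs e)
  have uniq : ∀ {v x y}, P.Adj v x → P.Adj v y → x = y := fun h h' => hP.eq_of_adj_left h h'
  have hne := hw.adj_sub.ne
  rcases hc w with rfl | rfl | rfl | rfl | rfl | rfl
  · have := uniq pab hw.symm; tauto
  · have := uniq pab.symm hw.symm; tauto
  · have := uniq pcd hw.symm; tauto
  · have := uniq pcd.symm hw.symm; tauto
  · tauto
  · exact hw.adj_sub

theorem exists_adj_of_not_colorable_two {a b c d e f : V}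
    (hc : ∀ v, v ∈ [a, b, c, d, e, f]) (hG : ¬ G.Colorable 2) :
    G.Adj a b ∨ G.Adj a c ∨ G.Adj b c ∨ G.Adj d e ∨ G.Adj d f ∨ G.Adj e f := by
  classical
  by_contra! h
  obtain ⟨h1, h2, h3, h4, h5, h6⟩ := h
  simp only [List.mem_cons, List.not_mem_nil, or_false] at hc
  refine hG ⟨Coloring.mk (fun v => if v = a ∨ v = b ∨ v = c then (0 : Fin 2) else 1) ?_⟩
  intro v w hvw
  have := hc v
  have := hc w
  have := hvw.symm
  have := hvw.ne
  grind

theorem Connected.exists_adj_mem_notMem (hG : G.Connected) {S : Set V} {x y : V} (hx : x ∈ S)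
    (hy : y ∉ S) : ∃ v ∈ S, ∃ w ∉ S, G.Adj v w := by
  obtain ⟨p⟩ := hG.preconnected x y
  obtain ⟨d, -, h1, h2⟩ := p.exists_boundary_dart S hx hy
  exact ⟨_, h1, _, h2, d.adj⟩

theorem Connected.exists_adj_of_pair (hG : G.Connected) {a b c d e f : V}
    (hn : [a, b, c, d, e, f].Nodup) (hc : ∀ v, v ∈ [a, b, c, d, e, f]) :
    G.Adj a c ∨ G.Adj a d ∨ G.Adj a e ∨ G.Adj a f ∨
      G.Adj b c ∨ G.Adj b d ∨ G.Adj b e ∨ G.Adj b f := by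
  have hca : c ∉ ({a, b} : Set V) := by
    simp only [Set.mem_insert_iff, Set.mem_singleton_iff]
    grind
  obtain ⟨v, hv, w, hw, h⟩ := hG.exists_adj_mem_notMem (S := {a, b}) (Set.mem_insert a _) hca
  have := hc w
  simp only [Set.mem_insert_iff, Set.mem_singleton_iff] at hv hw
  grind

theorem eq_top_of_isExtendable_two [Fintype V] (hV : Fintype.card V = 6) (hG : IsExtendable G 2)
    (hG2 : ¬ G.Colorable 2) : G = ⊤ := by
  obtain ⟨M, hM, h2⟩ := hG.2.1
  obtain ⟨a, b, c, d, hab, hcd, hn, -⟩ := hM.exists_eq_sup_of_ncard_eq_two h2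
  obtain ⟨e, f, hn, hc⟩ := exists_pair_of_nodup_of_card_eq_six hV hn
  have hef : G.Adj e f := adj_of_isExtendable_two hG hn hc hab hcd
  let p : Fin 6 → V := [a, b, c, d, e, f].get
  have nodup : ∀ {i j k l m n : Fin 6}, [i, j, k, l, m, n].Nodup →
      [p i, p j, p k, p l, p m, p n].Nodup := fun h =>
    h.map (List.nodup_iff_injective_get.1 hn)
  have ext : ∀ i j k l m n : Fin 6, [i, j, k, l, m, n].Nodup →
      G.Adj (p i) (p j) → G.Adj (p k) (p l) → G.Adj (p m) (p n) := fun _ _ _ _ _ _ h =>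
    adj_of_isExtendable_two hG (nodup h) ((nodup h).mem_of_length_eq_card hV.symm)
  have col : ∀ i j k l m n : Fin 6, [i, j, k, l, m, n].Nodup →
      G.Adj (p i) (p j) ∨ G.Adj (p i) (p k) ∨ G.Adj (p j) (p k) ∨
        G.Adj (p l) (p m) ∨ G.Adj (p l) (p n) ∨ G.Adj (p m) (p n) := fun _ _ _ _ _ _ h =>
    exists_adj_of_not_colorable_two ((nodup h).mem_of_length_eq_card hV.symm) hG2
  have con : ∀ i j k l m n : Fin 6, [i, j, k, l, m, n].Nodup →
      G.Adj (p i) (p k) ∨ G.Adj (p i) (p l) ∨ G.Adj (p i) (p m) ∨ G.Adj (p i) (p n) ∨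
        G.Adj (p j) (p k) ∨ G.Adj (p j) (p l) ∨ G.Adj (p j) (p m) ∨ G.Adj (p j) (p n) :=
    fun _ _ _ _ _ _ h =>
    hG.1.exists_adj_of_pair (nodup h) ((nodup h).mem_of_length_eq_card hV.symm)
  have h1 : G.Adj a c ∨ G.Adj a d ∨ G.Adj a e ∨ G.Adj a f ∨
      G.Adj b c ∨ G.Adj b d ∨ G.Adj b e ∨ G.Adj b f :=
    con 0 1 2 3 4 5 (by decide)
  have h2 : G.Adj c a ∨ G.Adj c b ∨ G.Adj c e ∨ G.Adj c f ∨
      G.Adj d a ∨ G.Adj d b ∨ G.Adj d e ∨ G.Adj d f :=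
    con 2 3 0 1 4 5 (by decide)
  have h3 : G.Adj e a ∨ G.Adj e b ∨ G.Adj e c ∨ G.Adj e d ∨
      G.Adj f a ∨ G.Adj f b ∨ G.Adj f c ∨ G.Adj f d :=
    con 4 5 0 1 2 3 (by decide)
  have l1 : G.Adj a d ∨ G.Adj a e ∨ G.Adj d e ∨ G.Adj b c ∨ G.Adj b f ∨ G.Adj c f :=
    col 0 3 4 1 2 5 (by decide)
  have l2 : G.Adj a d ∨ G.Adj a f ∨ G.Adj d f ∨ G.Adj b c ∨ G.Adj b e ∨ G.Adj c e :=
    col 0 3 5 1 2 4 (by decide)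
  have l3 : G.Adj a c ∨ G.Adj a e ∨ G.Adj c e ∨ G.Adj b d ∨ G.Adj b f ∨ G.Adj d f :=
    col 0 2 4 1 3 5 (by decide)
  have l4 : G.Adj a c ∨ G.Adj a f ∨ G.Adj c f ∨ G.Adj b d ∨ G.Adj b e ∨ G.Adj d e :=
    col 0 2 5 1 3 4 (by decide)
  have ac_iff : G.Adj a c ↔ G.Adj b d :=
    ⟨ext 4 5 0 2 1 3 (by decide) hef, ext 4 5 1 3 0 2 (by decide) hef⟩
  have ad_iff : G.Adj a d ↔ G.Adj b c :=
    ⟨ext 4 5 0 3 1 2 (by decide) hef, ext 4 5 1 2 0 3 (by decide) hef⟩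
  have ae_iff : G.Adj a e ↔ G.Adj b f :=
    ⟨ext 2 3 0 4 1 5 (by decide) hcd, ext 2 3 1 5 0 4 (by decide) hcd⟩
  have af_iff : G.Adj a f ↔ G.Adj b e :=
    ⟨ext 2 3 0 5 1 4 (by decide) hcd, ext 2 3 1 4 0 5 (by decide) hcd⟩
  have ce_iff : G.Adj c e ↔ G.Adj d f :=
    ⟨ext 0 1 2 4 3 5 (by decide) hab, ext 0 1 3 5 2 4 (by decide) hab⟩
  have cf_iff : G.Adj c f ↔ G.Adj d e :=
    ⟨ext 0 1 2 5 3 4 (by decide) hab, ext 0 1 3 4 2 5 (by decide) hab⟩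
  have e1 : G.Adj a c → G.Adj b e → G.Adj d f :=
    ext 0 2 1 4 3 5 (by decide)
  have e2 : G.Adj a c → G.Adj d f → G.Adj b e :=
    ext 0 2 3 5 1 4 (by decide)
  have e3 : G.Adj b e → G.Adj d f → G.Adj a c :=
    ext 1 4 3 5 0 2 (by decide)
  have e4 : G.Adj a c → G.Adj b f → G.Adj d e :=
    ext 0 2 1 5 3 4 (by decide)
  have e5 : G.Adj a c → G.Adj d e → G.Adj b f :=
    ext 0 2 3 4 1 5 (by decide)
  have e6 : G.Adj b f → G.Adj d e → G.Adj a c :=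
    ext 1 5 3 4 0 2 (by decide)
  have e7 : G.Adj a d → G.Adj b e → G.Adj c f :=
    ext 0 3 1 4 2 5 (by decide)
  have e8 : G.Adj a d → G.Adj c f → G.Adj b e :=
    ext 0 3 2 5 1 4 (by decide)
  have e9 : G.Adj b e → G.Adj c f → G.Adj a d :=
    ext 1 4 2 5 0 3 (by decide)
  have e10 : G.Adj a d → G.Adj b f → G.Adj c e :=
    ext 0 3 1 5 2 4 (by decide)
  have e11 : G.Adj a d → G.Adj c e → G.Adj b f :=
    ext 0 3 2 4 1 5 (by decide)
  have e12 : G.Adj b f → G.Adj c e → G.Adj a d :=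
    ext 1 5 2 4 0 3 (by decide)
  simp only [G.adj_comm c a, G.adj_comm c b, G.adj_comm d a, G.adj_comm d b, G.adj_comm e a,
    G.adj_comm e b, G.adj_comm e c, G.adj_comm e d, G.adj_comm f a, G.adj_comm f b,
    G.adj_comm f c, G.adj_comm f d] at h2 h3
  have all : G.Adj a c ∧ G.Adj a d ∧ G.Adj a e ∧ G.Adj a f ∧ G.Adj c e ∧ G.Adj c f := by
    clear ext col con nodup hn hc
    grind (splits := 20)
  simp only [List.mem_cons, List.not_mem_nil, or_false] at hc
  ext v w
  refine ⟨fun h => h.ne, fun h => ?_⟩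
  have := hc v
  have := hc w
  rw [top_adj] at h
  clear ext col con nodup
  grind [G.adj_comm]

theorem ncard_edgeSet_top [Fintype V] :
    (⊤ : SimpleGraph V).edgeSet.ncard = (Fintype.card V).choose 2 := by
  classical
  rw [← card_edgeFinset_top_eq_card_choose_two, ← coe_edgeFinset, Set.ncard_coe_finset]

theorem isExtendable_two_top [Fintype V] (hV : Fintype.card V = 6) :
    IsExtendable (⊤ : SimpleGraph V) 2 := by
  have : Nonempty V := Fintype.card_pos_iff.1 (by omega)
  refine ⟨connected_top, ?_, fun M hM h2 => ?_⟩
  · let g : Fin 6 ↪ V := (Fintype.equivFinOfCardEq hV).symm.toEmbedding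
    have hg : ∀ i j, i ≠ j → (⊤ : SimpleGraph V).Adj (g i) (g j) := fun i j h =>
      g.injective.ne h
    exact ⟨subgraphOfAdj _ (hg 0 1 (by decide)) ⊔ subgraphOfAdj _ (hg 2 3 (by decide)),
      isMatching_subgraphOfAdj_sup _ _ (hg 0 2 (by decide)) (hg 0 3 (by decide))
        (hg 1 2 (by decide)) (hg 1 3 (by decide)),
      ncard_edgeSet_subgraphOfAdj_sup _ _ (hg 0 2 (by decide)) (hg 0 3 (by decide))⟩
  · obtain ⟨a, b, c, d, hab, hcd, hn, rfl⟩ := hM.exists_eq_sup_of_ncard_eq_two h2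
    obtain ⟨e, f, hn, hc⟩ := exists_pair_of_nodup_of_card_eq_six hV hn
    simp only [List.nodup_cons, List.mem_cons, List.not_mem_nil, or_false, not_or] at hn hc
    have hef : (⊤ : SimpleGraph V).Adj e f := by rw [top_adj]; tauto
    refine ⟨(subgraphOfAdj _ hab ⊔ subgraphOfAdj _ hcd) ⊔ subgraphOfAdj _ hef, ⟨?_, ?_⟩,
      le_sup_left⟩
    · refine hM.sup (Subgraph.IsMatching.subgraphOfAdj hef) ?_
      rw [hM.support_eq_verts, support_subgraphOfAdj]
      simp
      grind
    · intro v
      have := hc v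
      simp
      tauto

end SimpleGraph

theorem eps_six_two :
    (∀ (V : Type) [Fintype V] (G : SimpleGraph V), Fintype.card V = 6 →
      IsExtendable G 2 → ¬ G.Colorable 2 → 15 ≤ G.edgeSet.ncard ∧ G = ⊤) ∧
    (IsExtendable (⊤ : SimpleGraph (Fin 6)) 2 ∧ ¬ (⊤ : SimpleGraph (Fin 6)).Colorable 2 ∧
      (⊤ : SimpleGraph (Fin 6)).edgeSet.ncard = 15) := by
  refine ⟨fun V _ G hV hG hG2 => ?_, isExtendable_two_top (Fintype.card_fin 6), fun h => ?_, ?_⟩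
  · obtain rfl := eq_top_of_isExtendable_two hV hG hG2
    rw [ncard_edgeSet_top, hV]
    exact ⟨le_rfl, rfl⟩
  · have := h.card_le_of_pairwise_adj id fun _ _ h => h
    simp at this
  · rw [ncard_edgeSet_top, Fintype.card_fin]; rfl
end

section
/- Every 2-extendable non-bipartite finite simple graph on 8 vertices has at least 16 edges, and there exists a 2-extendable non-bipartite finite simple graph on 8 vertices with exactly 16 edges; hence ε(8,2) = 16. -/
open SimpleGraph

/-- `f` sends every vertex to its partner in some perfect matching of `G`. -/
def IsPartner {V : Type*} (G : SimpleGraph V) (f : V → V) : Prop :=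
  (∀ x, G.Adj x (f x)) ∧ ∀ x, f (f x) = x

theorem SimpleGraph.Subgraph.IsPerfectMatching.exists_isPartner {V : Type*} {G : SimpleGraph V}
    {P : G.Subgraph} (hP : P.IsPerfectMatching) :
    ∃ f, IsPartner G f ∧ ∀ x y, P.Adj x y → f x = y := by
  rw [Subgraph.isPerfectMatching_iff] at hP
  choose f hf hu using hP
  exact ⟨f, ⟨fun x => (hf x).adj_sub, fun x => (hu _ _ (hf x).symm).symm⟩,
    fun x y h => (hu x y h).symm⟩

theorem IsExtendable.exists_isPartner {V : Type*} {G : SimpleGraph V} {k : ℕ}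
    (h : IsExtendable G k) : ∃ f, IsPartner G f := by
  obtain ⟨M, hM, hk⟩ := h.2.1
  obtain ⟨P, hP, -⟩ := h.2.2 M hM hk
  exact hP.exists_isPartner.imp fun _ => And.left

/-- `PairExtends G` says that any two disjoint edges of `G` lie in a common perfect matching, the
latter being encoded by its partner function. -/
def PairExtends {V : Type*} (G : SimpleGraph V) : Prop :=
  ∀ p q r s : V, G.Adj p q → G.Adj r s → p ≠ r → p ≠ s → q ≠ r → q ≠ s →
    ∃ f, IsPartner G f ∧ f p = q ∧ f r = s

theorem IsExtendable.pairExtends {V : Type*} {G : SimpleGraph V} (h : IsExtendable G 2) :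
    PairExtends G := by
  intro p q r s hpq hrs hpr hps hqr hqs
  have hM : (G.subgraphOfAdj hpq ⊔ G.subgraphOfAdj hrs).IsMatching := by
    refine (Subgraph.IsMatching.subgraphOfAdj hpq).sup (Subgraph.IsMatching.subgraphOfAdj hrs) ?_
    simp [support_subgraphOfAdj, hpr.symm, hps.symm, hqr.symm, hqs.symm]
  obtain ⟨P, hP, hle⟩ := h.2.2 _ hM (by
    simp only [Subgraph.edgeSet_sup, edgeSet_subgraphOfAdj, Set.singleton_union]
    apply Set.ncard_pair
    simp [hpr, hps])
  obtain ⟨f, hf, hPf⟩ := hP.exists_isPartner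
  refine ⟨f, hf, hPf _ _ (hle.2 ?_), hPf _ _ (hle.2 ?_)⟩ <;> simp

theorem SimpleGraph.Connected.forall_mem_of_adj_closed {V : Type*} {G : SimpleGraph V}
    (hG : G.Connected) {S : Set V} {v : V} (hv : v ∈ S)
    (hS : ∀ x ∈ S, ∀ y, G.Adj x y → y ∈ S) (w : V) : w ∈ S := by
  obtain ⟨p⟩ := hG.preconnected v w
  induction p with
  | nil => exact hv
  | cons h _ ih => exact ih (hS _ hv _ h)

theorem PairExtends.exists_adj_ne {V : Type*} {G : SimpleGraph V} (hE : PairExtends G)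
    {p q r s v : V} (hpq : G.Adj p q) (hrs : G.Adj r s) (hpr : p ≠ r) (hps : p ≠ s)
    (hqr : q ≠ r) (hqs : q ≠ s) (hv : v ≠ p ∧ v ≠ q ∧ v ≠ r ∧ v ≠ s) :
    ∃ u, G.Adj v u ∧ u ≠ p ∧ u ≠ q ∧ u ≠ r ∧ u ≠ s := by
  obtain ⟨f, ⟨hf, hff⟩, h1, h2⟩ := hE p q r s hpq hrs hpr hps hqr hqs
  refine ⟨f v, hf v, ?_⟩
  grind

theorem PairExtends.adj_imp_of_adj {V : Type*} {G : SimpleGraph V} (hE : PairExtends G)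
    {v a b c : V} (hN : ∀ x, G.Adj v x → x = a ∨ x = b ∨ x = c) (hv : v ≠ a ∧ v ≠ b ∧ v ≠ c)
    (hac : a ≠ c) (hbc : b ≠ c) (hab : G.Adj a b) (d : V) (hd : G.Adj c d) :
    d = v ∨ d = a ∨ d = b := by
  by_contra! h
  obtain ⟨u, hu, h'⟩ := hE.exists_adj_ne (v := v) hab hd hac h.2.1.symm hbc h.2.2.symm
    ⟨hv.1, hv.2.1, hv.2.2, h.1.symm⟩
  have := hN u hu
  tauto

section MinDegree

variable {V : Type*} [Fintype V] {G : SimpleGraph V}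

theorem exists_ne_of_card_eq_eight (hV : Fintype.card V = 8) (a b c d : V) :
    ∃ x, x ≠ a ∧ x ≠ b ∧ x ≠ c ∧ x ≠ d := by
  classical
  by_contra! h
  have : (Finset.univ : Finset V) ⊆ {a, b, c, d} := by
    intro x _
    simp only [Finset.mem_insert, Finset.mem_singleton]
    have := h x
    tauto
  have := (Finset.card_le_card this).trans Finset.card_le_four
  rw [Finset.card_univ] at this
  omega

/-- No nonempty set of at most four vertices of a connected graph on eight vertices is closed under
adjacency. -/
theorem not_adj_closed_four (hV : Fintype.card V = 8) (hG : G.Connected) (a b c d : V)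
    (h : ∀ x, (x = a ∨ x = b ∨ x = c ∨ x = d) → ∀ y, G.Adj x y →
      (y = a ∨ y = b ∨ y = c ∨ y = d)) : False := by
  obtain ⟨x, hx⟩ := exists_ne_of_card_eq_eight hV a b c d
  have := hG.forall_mem_of_adj_closed (S := {x | x = a ∨ x = b ∨ x = c ∨ x = d})
    (Or.inl rfl : a ∈ _) h x
  simp only [Set.mem_ofPred_eq] at this
  tauto

theorem PairExtends.not_adj_of_two (hE : PairExtends G) (hV : Fintype.card V = 8)
    (hPM : ∃ f, IsPartner G f) {v a b : V}
    (hN : ∀ x, G.Adj v x → x = a ∨ x = b) (hva : v ≠ a) (hvb : v ≠ b) : ¬ G.Adj a b := by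
  intro hab
  obtain ⟨c, hca, hcb, hcv, -⟩ := exists_ne_of_card_eq_eight hV a b v v
  obtain ⟨d, hda, hdb, hdv, hdc⟩ := exists_ne_of_card_eq_eight hV a b v c
  have key : ∀ c, c ≠ a → c ≠ b → c ≠ v → ∀ x, G.Adj c x → x = a ∨ x = b := by
    intro c hca hcb hcv x hx
    rcases hE.adj_imp_of_adj (c := c) (fun x hx => by have := hN x hx; tauto)
      ⟨hva, hvb, hcv.symm⟩ hca.symm hcb.symm hab x hx with rfl | h | h
    · have := hN c hx.symm; tauto
    · exact Or.inl h
    · exact Or.inr h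
  obtain ⟨f, hf, hff⟩ := hPM
  have h1 := hN _ (hf v)
  have h2 := key c hca hcb hcv _ (hf c)
  have h3 := key d hda hdb hdv _ (hf d)
  grind

theorem PairExtends.exists_adj_ne_one (hE : PairExtends G) (hV : Fintype.card V = 8)
    (hPM : ∃ f, IsPartner G f) (hG : G.Connected) (v a : V) :
    ∃ x, G.Adj v x ∧ x ≠ a := by
  by_contra! hN
  have hva : G.Adj v a := by
    obtain ⟨f, hf, -⟩ := hPM
    exact hN _ (hf v) ▸ hf v
  refine not_adj_closed_four hV hG v a a a ?_
  rintro x hx y hy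
  by_contra! h
  rcases hx with rfl | hx
  · have := hN y hy; tauto
  · have hay : G.Adj a y := by rcases hx with rfl | rfl | rfl <;> exact hy
    exact hE.not_adj_of_two hV hPM (a := a) (b := y) (fun x hx => Or.inl (hN x hx)) hva.ne
      h.1.symm hay

/-- Every vertex has at least three neighbours. -/
theorem PairExtends.exists_adj_ne_two (hE : PairExtends G) (hV : Fintype.card V = 8)
    (hPM : ∃ f, IsPartner G f) (hG : G.Connected)
    (v a b : V) : ∃ x, G.Adj v x ∧ x ≠ a ∧ x ≠ b := by
  by_contra! hN'
  have hone := hE.exists_adj_ne_one hV hPM hG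
  have hN : ∀ x, G.Adj v x → x = a ∨ x = b := fun x hx => by
    have := hN' x hx; tauto
  have hva : G.Adj v a := by
    obtain ⟨x, hx, hxb⟩ := hone v b
    rcases hN x hx with rfl | rfl
    · exact hx
    · exact absurd rfl hxb
  have hvb : G.Adj v b := by
    obtain ⟨x, hx, hxa⟩ := hone v a
    rcases hN x hx with rfl | rfl
    · exact absurd rfl hxa
    · exact hx
  have hab : a ≠ b := by
    rintro rfl
    obtain ⟨x, hx, hxa⟩ := hone v a
    have := hN x hx; tauto
  have key : ∀ v a b : V, (∀ x, G.Adj v x → x = a ∨ x = b) → a ≠ b → v ≠ a → v ≠ b →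
      ∀ c d, G.Adj a c → G.Adj b d → c ≠ v → d ≠ v → c = d := by
    intro v a b hN hab hva hvb c d hac hbd hcv hdv
    have hnab := hE.not_adj_of_two hV hPM hN hva hvb
    by_contra hcd
    obtain ⟨u, hu, h⟩ := hE.exists_adj_ne (v := v) hac hbd hab
      (by rintro rfl; exact hnab hbd.symm) (by rintro rfl; exact hnab hac) hcd
      ⟨hva, hcv.symm, hvb, hdv.symm⟩
    have := hN u hu
    tauto
  have hnab := hE.not_adj_of_two hV hPM hN hva.ne hvb.ne
  obtain ⟨d, had, hdv⟩ := hone a v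
  obtain ⟨d', hbd, hdv'⟩ := hone b v
  have hk := key v a b hN hab hva.ne hvb.ne
  obtain rfl := hk d d' had hbd hdv hdv'
  have hNa : ∀ x, G.Adj a x → x = v ∨ x = d := fun x hx => by
    by_contra! h
    exact h.2 (hk x d hx hbd h.1 hdv)
  have hNb : ∀ x, G.Adj b x → x = v ∨ x = d := fun x hx => by
    by_contra! h
    exact h.2 (hk d x had hx hdv h.1).symm
  have hNd : ∀ x, G.Adj d x → x = a ∨ x = b := fun x hx => by
    by_contra! h
    exact h.2 (key a v d hNa hdv.symm hva.ne.symm had.ne b x hvb hx hab.symm h.1).symm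
  refine not_adj_closed_four hV hG v a b d ?_
  rintro x (rfl | rfl | rfl | rfl) y hy
  · have := hN y hy; tauto
  · have := hNa y hy; tauto
  · have := hNb y hy; tauto
  · have := hNd y hy; tauto

/-- The neighbourhood of a vertex of degree three is independent. -/
theorem PairExtends.not_adj_of_three (hE : PairExtends G) (hV : Fintype.card V = 8)
    (hPM : ∃ f, IsPartner G f) (hG : G.Connected)
    {v a b c : V} (hN : ∀ x, G.Adj v x → x = a ∨ x = b ∨ x = c)
    (hv : v ≠ a ∧ v ≠ b ∧ v ≠ c) (hac : a ≠ c) (hbc : b ≠ c) : ¬ G.Adj a b := by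
  intro hab
  have hNc := hE.adj_imp_of_adj hN hv hac hbc hab
  have hca : G.Adj c a := by
    obtain ⟨x, hx, h1, h2⟩ := hE.exists_adj_ne_two hV hPM hG c v b
    rcases hNc x hx with rfl | rfl | rfl <;> tauto
  have hcb : G.Adj c b := by
    obtain ⟨x, hx, h1, h2⟩ := hE.exists_adj_ne_two hV hPM hG c v a
    rcases hNc x hx with rfl | rfl | rfl <;> tauto
  have hNb := hE.adj_imp_of_adj (v := v) (a := c) (b := a) (c := b)
    (fun x hx => by have := hN x hx; tauto) (by tauto) hbc.symm hab.ne hca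
  have hNa := hE.adj_imp_of_adj (v := v) (a := c) (b := b) (c := a)
    (fun x hx => by have := hN x hx; tauto) (by tauto) hac.symm hab.ne.symm hcb
  refine not_adj_closed_four hV hG v a b c ?_
  rintro x (rfl | rfl | rfl | rfl) y hy
  · have := hN y hy; tauto
  · have := hNa y hy; tauto
  · have := hNb y hy; tauto
  · have := hNc y hy; tauto

end MinDegree

section Bipartite

variable {V : Type*} {G : SimpleGraph V} {v a b c i j k l : V}

theorem PairExtends.adj_of_adj_of_adj (hE : PairExtends G)
    (hcov : ∀ x, x ∈ [v, a, b, c, i, j, k, l]) (hnd : [v, a, b, c, i, j, k, l].Nodup)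
    (hN : ∀ x, G.Adj v x → x = a ∨ x = b ∨ x = c) (hai : G.Adj a i) (hbj : G.Adj b j) :
    G.Adj k l := by
  simp only [List.nodup_cons, List.mem_cons, List.not_mem_nil, or_false, not_or] at hnd hcov
  obtain ⟨f, ⟨hf, hff⟩, h1, h2⟩ := hE a i b j hai hbj (by tauto) (by tauto) (by tauto) (by tauto)
  have hv := hN _ (hf v)
  have hk := hcov (f k)
  have hkk := (hf k).ne
  have : f k = l := by grind
  exact this ▸ hf k

theorem PairExtends.not_adj_of_adj (hE : PairExtends G)
    (hcov : ∀ x, x ∈ [v, a, b, c, i, j, k, l]) (hnd : [v, a, b, c, i, j, k, l].Nodup)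
    (hab : ¬ G.Adj a b) (hac : ¬ G.Adj a c) (hbc : ¬ G.Adj b c) (hij : G.Adj i j) :
    ¬ G.Adj k l := by
  intro hkl
  simp only [List.nodup_cons, List.mem_cons, List.not_mem_nil, or_false, not_or] at hnd hcov
  obtain ⟨f, ⟨hf, hff⟩, h1, h2⟩ := hE i j k l hij hkl (by tauto) (by tauto) (by tauto) (by tauto)
  have ha : f a = v := by
    have := hcov (f a)
    have := hf a
    grind [G.irrefl]
  have hb : f b = v := by
    have := hcov (f b)
    have := hf b
    grind [G.irrefl, G.adj_comm]
  grind

theorem colorable_two_of_cover (hcov : ∀ x, x ∈ [v, a, b, c, i, j, k, l])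
    (hnd : [v, a, b, c, i, j, k, l].Nodup)
    (hN : ∀ x, G.Adj v x → x = a ∨ x = b ∨ x = c)
    (hab : ¬ G.Adj a b) (hac : ¬ G.Adj a c) (hbc : ¬ G.Adj b c)
    (hij : ¬ G.Adj i j) (hik : ¬ G.Adj i k) (hjk : ¬ G.Adj j k)
    (hal : ¬ G.Adj a l) (hbl : ¬ G.Adj b l) (hcl : ¬ G.Adj c l) : G.Colorable 2 := by
  classical
  simp only [List.nodup_cons, List.mem_cons, List.not_mem_nil, or_false, not_or] at hnd hcov
  refine ⟨Coloring.mk (fun x => if x = v ∨ x = i ∨ x = j ∨ x = k then (0 : Fin 2) else 1) ?_⟩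
  intro x y hxy
  have hx := hcov x
  have hy := hcov y
  have hxv := hN x
  have hyv := hN y
  have := hxy.symm
  have := hxy.ne
  split_ifs <;> simp <;> grind

/-- The combinatorial core of `PairExtends.colorable_two`: `A` records the adjacencies between the
three neighbours of a vertex and the remaining four vertices, `B` those among the latter. -/
theorem exists_star_center {A : Fin 3 → Fin 4 → Prop} {B : Fin 4 → Fin 4 → Prop}
    (hB : ∀ p q, B p q → B q p)
    (hA : ∀ x p, ∃ q, q ≠ p ∧ A x q)
    (hd : ∀ p q r s, [p, q, r, s].Nodup → (∃ x, A x p) ∨ B p q)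
    (hAB : ∀ x y p q r s, x ≠ y → [p, q, r, s].Nodup → A x p → A y q → B r s)
    (hBB : ∀ p q r s, [p, q, r, s].Nodup → B p q → ¬ B r s) :
    ∃ i j k l, [i, j, k, l].Nodup ∧ (∀ x, ¬ A x l) ∧ ¬ B i j ∧ ¬ B i k ∧ ¬ B j k := by
  by_contra! h
  have h0 := h 1 2 3 0 (by decide)
  have h1 := h 0 2 3 1 (by decide)
  have h2 := h 0 1 3 2 (by decide)
  have h3 := h 0 1 2 3 (by decide)
  clear h
  simp [Fin.forall_fin_succ, Fin.exists_fin_succ] at *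
  grind (splits := 300)

/-- A pair-extendable graph on eight vertices with a vertex of degree three is bipartite. -/
theorem PairExtends.colorable_two [Fintype V] (hE : PairExtends G) (hV : Fintype.card V = 8)
    (hPM : ∃ f, IsPartner G f) (hG : G.Connected) {T : Finset V} (hT : T.card = 3) (hvT : v ∉ T)
    (hN : ∀ x, G.Adj v x → x ∈ T) : G.Colorable 2 := by
  classical
  have hW : (insert v T)ᶜ.card = 4 := by
    rw [Finset.card_compl, Finset.card_insert_of_notMem hvT, hT, hV]
  obtain ⟨u, hu, hu'⟩ : ∃ u : Fin 3 → V, u.Injective ∧ ∀ x, x ∈ T ↔ ∃ i, u i = x := by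
    let e := (T.equivFinOfCardEq hT).symm
    exact ⟨fun i => e i, fun i j h => e.injective (Subtype.ext h),
      fun x => ⟨fun hx => ⟨e.symm ⟨x, hx⟩, by simp⟩, fun ⟨i, hi⟩ => hi ▸ (e i).2⟩⟩
  obtain ⟨w, hw, hw'⟩ : ∃ w : Fin 4 → V, w.Injective ∧ ∀ x, x ∈ (insert v T)ᶜ ↔ ∃ i, w i = x := by
    let e := ((insert v T)ᶜ.equivFinOfCardEq hW).symm
    exact ⟨fun i => e i, fun i j h => e.injective (Subtype.ext h),
      fun x => ⟨fun hx => ⟨e.symm ⟨x, hx⟩, by simp⟩, fun ⟨i, hi⟩ => hi ▸ (e i).2⟩⟩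
  have hvu : ∀ i, v ≠ u i := fun i h => hvT ((hu' v).2 ⟨i, h.symm⟩)
  have hw'' : ∀ i, w i ≠ v ∧ w i ∉ T := fun i => by
    simpa using (hw' (w i)).2 ⟨i, rfl⟩
  have huw : ∀ i j, u i ≠ w j := fun i j h => (hw'' j).2 ((hu' _).2 ⟨i, h⟩)
  have hcov : ∀ x, x = v ∨ (∃ i, x = u i) ∨ ∃ i, x = w i := by
    intro x
    by_cases hx : x ∈ (insert v T)ᶜ
    · obtain ⟨i, rfl⟩ := (hw' x).1 hx
      exact Or.inr (Or.inr ⟨i, rfl⟩)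
    · rw [Finset.mem_compl, not_not, Finset.mem_insert] at hx
      refine hx.imp id fun hx => ?_
      obtain ⟨i, rfl⟩ := (hu' x).1 hx
      exact Or.inl ⟨i, rfl⟩
  have cover₃ : ∀ x y z : Fin 3, [x, y, z].Nodup → ∀ i, i = x ∨ i = y ∨ i = z := by decide
  have cover₄ : ∀ p q r s : Fin 4, [p, q, r, s].Nodup → ∀ i, i = p ∨ i = q ∨ i = r ∨ i = s := by
    decide
  have hcovL : ∀ x y z p q r s, [x, y, z].Nodup → [p, q, r, s].Nodup →
      ∀ t, t ∈ [v, u x, u y, u z, w p, w q, w r, w s] := by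
    intro x y z p q r s h3 h4 t
    rcases hcov t with rfl | ⟨i, rfl⟩ | ⟨i, rfl⟩
    · simp
    · rcases cover₃ x y z h3 i with rfl | rfl | rfl <;> simp
    · rcases cover₄ p q r s h4 i with rfl | rfl | rfl | rfl <;> simp
  have hndL : ∀ x y z p q r s, [x, y, z].Nodup → [p, q, r, s].Nodup →
      [v, u x, u y, u z, w p, w q, w r, w s].Nodup := by
    intro x y z p q r s h3 h4
    have hvw : ∀ i, v ≠ w i := fun i => (hw'' i).1.symm
    simp only [List.nodup_cons, List.mem_cons, List.not_mem_nil, or_false, not_or] at h3 h4 ⊢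
    simp [hvu, huw, hvw, hu.eq_iff, hw.eq_iff]
    tauto
  have hNL : ∀ x y z, [x, y, z].Nodup → ∀ t, G.Adj v t → t = u x ∨ t = u y ∨ t = u z := by
    intro x y z h3 t ht
    obtain ⟨i, rfl⟩ := (hu' t).1 (hN t ht)
    rcases cover₃ x y z h3 i with rfl | rfl | rfl <;> simp
  have third : ∀ x y : Fin 3, x ≠ y → ∃ z, [x, y, z].Nodup := by decide
  have hind : ∀ x y, ¬ G.Adj (u x) (u y) := by
    intro x y hxy
    have hne : x ≠ y := by rintro rfl; exact G.irrefl hxy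
    obtain ⟨z, hz⟩ := third x y hne
    refine hE.not_adj_of_three hV hPM hG (hNL x y z hz) ⟨hvu x, hvu y, hvu z⟩ ?_ ?_ hxy
    all_goals
      rw [hu.ne_iff]
      simp at hz
      tauto
  have hvw : ∀ i, ¬ G.Adj v (w i) := fun i h => (hw'' i).2 (hN _ h)
  obtain ⟨i, j, k, l, hnd, hl, hij, hik, hjk⟩ := exists_star_center
    (A := fun x p => G.Adj (u x) (w p)) (B := fun p q => G.Adj (w p) (w q))
    (fun p q h => h.symm)
    (by
      intro x p
      obtain ⟨t, ht, htv, htp⟩ := hE.exists_adj_ne_two hV hPM hG (u x) v (w p)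
      rcases hcov t with rfl | ⟨i, rfl⟩ | ⟨i, rfl⟩
      · exact absurd rfl htv
      · exact absurd ht (hind x i)
      · exact ⟨i, hw.ne_iff.1 htp, ht⟩)
    (by
      intro p q r s hnd
      obtain ⟨t, ht, htr, hts⟩ := hE.exists_adj_ne_two hV hPM hG (w p) (w r) (w s)
      rcases hcov t with rfl | ⟨i, rfl⟩ | ⟨i, rfl⟩
      · exact absurd ht.symm (hvw p)
      · exact Or.inl ⟨i, ht.symm⟩
      · rcases cover₄ p q r s hnd i with rfl | rfl | rfl | rfl
        · exact absurd ht G.irrefl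
        · exact Or.inr ht
        · exact absurd rfl htr
        · exact absurd rfl hts)
    (by
      intro x y p q r s hxy hnd hxp hyq
      obtain ⟨z, hz⟩ := third x y hxy
      exact hE.adj_of_adj_of_adj (hcovL x y z p q r s hz hnd) (hndL x y z p q r s hz hnd)
        (hNL x y z hz) hxp hyq)
    (by
      intro p q r s hnd hpq
      exact hE.not_adj_of_adj (hcovL 0 1 2 p q r s (by decide) hnd)
        (hndL 0 1 2 p q r s (by decide) hnd) (hind _ _) (hind _ _) (hind _ _) hpq)
  exact colorable_two_of_cover (hcovL 0 1 2 i j k l (by decide) hnd)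
    (hndL 0 1 2 i j k l (by decide) hnd) (hNL 0 1 2 (by decide)) (hind _ _) (hind _ _) (hind _ _)
    hij hik hjk (hl _) (hl _) (hl _)

end Bipartite

theorem IsExtendable.sixteen_le_ncard_edgeSet {V : Type*} [Fintype V] {G : SimpleGraph V}
    (hV : Fintype.card V = 8) (hG : IsExtendable G 2) (hG2 : ¬ G.Colorable 2) :
    16 ≤ G.edgeSet.ncard := by
  classical
  have hdeg : ∀ v, 4 ≤ G.degree v := by
    intro v
    by_contra! hv
    obtain ⟨T, hT₁, hT₂, hT₃⟩ := Finset.exists_subsuperset_card_eq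
      (s := G.neighborFinset v) (t := {v}ᶜ) (n := 3)
      (by intro x hx; simpa using ((G.mem_neighborFinset v x).1 hx).ne')
      (by rw [card_neighborFinset_eq_degree]; omega)
      (by rw [Finset.card_compl, hV]; simp)
    exact hG2 (hG.pairExtends.colorable_two hV hG.exists_isPartner hG.1 hT₃
      (fun h => by simpa using hT₂ h) (fun x hx => hT₁ ((G.mem_neighborFinset v x).2 hx)))
  have hsum := G.sum_degrees_eq_twice_card_edges
  have hle : Finset.univ.card • 4 ≤ ∑ v, G.degree v :=
    Finset.card_nsmul_le_sum _ _ _ fun v _ => hdeg v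
  rw [Finset.card_univ, hV, smul_eq_mul] at hle
  rw [← coe_edgeFinset, Set.ncard_coe_finset]
  omega

/-- The Cartesian product of a complete graph on four vertices and an edge. -/
def prismOverK4 : SimpleGraph (Fin 8) where
  Adj x y := x ≠ y ∧ (x.val / 2 = y.val / 2 ∨ x.val % 2 = y.val % 2)
  symm := ⟨fun _ _ h => ⟨h.1.symm, h.2.imp Eq.symm Eq.symm⟩⟩
  loopless := ⟨fun _ h => h.1 rfl⟩

instance : DecidableRel prismOverK4.Adj := fun x y =>
  inferInstanceAs (Decidable (x ≠ y ∧ (x.val / 2 = y.val / 2 ∨ x.val % 2 = y.val % 2)))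

/-- The partner functions of the perfect matchings of `prismOverK4`. -/
def prismPartners : Fin 16 → Fin 8 → Fin 8 :=
  ![![1, 0, 3, 2, 5, 4, 7, 6], ![1, 0, 3, 2, 6, 7, 4, 5], ![1, 0, 4, 5, 2, 3, 7, 6],
   ![1, 0, 6, 7, 5, 4, 2, 3], ![2, 3, 0, 1, 5, 4, 7, 6], ![2, 3, 0, 1, 6, 7, 4, 5],
   ![2, 5, 0, 7, 6, 1, 4, 3], ![2, 7, 0, 5, 6, 3, 4, 1], ![4, 3, 6, 1, 0, 7, 2, 5],
   ![4, 5, 3, 2, 0, 1, 7, 6], ![4, 5, 6, 7, 0, 1, 2, 3], ![4, 7, 6, 5, 0, 3, 2, 1],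
   ![6, 3, 4, 1, 2, 7, 0, 5], ![6, 5, 4, 7, 2, 1, 0, 3], ![6, 7, 3, 2, 5, 4, 0, 1],
   ![6, 7, 4, 5, 2, 3, 0, 1]]

theorem isPartner_prismPartners (i : Fin 16) : IsPartner prismOverK4 (prismPartners i) := by
  unfold IsPartner
  decide +kernel +revert

set_option synthInstance.maxSize 2000 in
theorem pairExtends_prismOverK4 : PairExtends prismOverK4 := by
  have : ∀ p q, prismOverK4.Adj p q → ∀ r, p ≠ r → q ≠ r → ∀ s, prismOverK4.Adj r s →
      p ≠ s → q ≠ s → ∃ i, prismPartners i p = q ∧ prismPartners i r = s := by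
    decide +kernel
  intro p q r s hpq hrs hpr hps hqr hqs
  obtain ⟨i, h⟩ := this p q hpq r hpr hqr s hrs hps hqs
  exact ⟨prismPartners i, isPartner_prismPartners i, h⟩

theorem PairExtends.exists_isPerfectMatching {V : Type*} {G : SimpleGraph V} (hE : PairExtends G)
    (M : G.Subgraph) (hM : M.IsMatching) (hcard : M.edgeSet.ncard = 2) :
    ∃ P : G.Subgraph, P.IsPerfectMatching ∧ M ≤ P := by
  obtain ⟨e₁, e₂, hne, he⟩ := Set.ncard_eq_two.1 hcard
  induction e₁ with | h p q
  induction e₂ with | h r s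
  have hpq : M.Adj p q := by rw [← Subgraph.mem_edgeSet, he]; simp
  have hrs : M.Adj r s := by rw [← Subgraph.mem_edgeSet, he]; simp
  have hdisj : ∀ {a b c d}, s(a, b) ≠ s(c, d) → M.Adj a b → M.Adj c d → a ≠ c := by
    rintro a b c d h hab hcd rfl
    exact h (by rw [hM.eq_of_adj_left hab hcd])
  obtain ⟨f, ⟨hf, hff⟩, hp, hr⟩ := hE p q r s hpq.adj_sub hrs.adj_sub (hdisj hne hpq hrs)
    (hdisj (by rwa [Sym2.eq_swap (a := s)]) hpq hrs.symm)
    (hdisj (by rwa [Sym2.eq_swap (a := q)]) hpq.symm hrs)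
    (hdisj (by rwa [Sym2.eq_swap (a := q), Sym2.eq_swap (a := s)]) hpq.symm hrs.symm)
  refine ⟨⟨Set.univ, fun x y => f x = y, fun {x y} h => h ▸ hf x, fun _ => Set.mem_univ _,
    ⟨fun x y h => by rw [← h, hff]⟩⟩, ?_, fun _ _ => Set.mem_univ _, ?_⟩
  · exact Subgraph.isPerfectMatching_iff.2 fun x => ⟨f x, rfl, fun y (h : f x = y) => h.symm⟩
  · intro x y hxy
    have : s(x, y) ∈ M.edgeSet := hxy
    rw [he] at this
    change f x = y
    simp only [Set.mem_insert_iff, Set.mem_singleton_iff, Sym2.eq_iff] at this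
    rcases this with (⟨rfl, rfl⟩ | ⟨rfl, rfl⟩) | (⟨rfl, rfl⟩ | ⟨rfl, rfl⟩)
    · exact hp
    · rw [← hp, hff]
    · exact hr
    · rw [← hr, hff]

theorem isExtendable_prismOverK4 : IsExtendable prismOverK4 2 := by
  refine ⟨⟨?_⟩, ?_, pairExtends_prismOverK4.exists_isPerfectMatching⟩
  · have h : ∀ x : Fin 8, prismOverK4.Reachable x 0 := by
      intro x
      have : ∀ x : Fin 8, ∃ y, (x = y ∨ prismOverK4.Adj x y) ∧
          (y = 0 ∨ prismOverK4.Adj y 0) := by decide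
      obtain ⟨y, hxy, hy⟩ := this x
      refine Reachable.trans (v := y) ?_ ?_
      · exact hxy.elim (fun h => h ▸ Reachable.refl _) Adj.reachable
      · exact hy.elim (fun h => h ▸ Reachable.refl _) Adj.reachable
    exact fun x y => (h x).trans (h y).symm
  · have h₁ : prismOverK4.Adj 0 1 := by decide
    have h₂ : prismOverK4.Adj 2 3 := by decide
    refine ⟨prismOverK4.subgraphOfAdj h₁ ⊔ prismOverK4.subgraphOfAdj h₂, ?_, ?_⟩
    · refine (Subgraph.IsMatching.subgraphOfAdj h₁).sup (Subgraph.IsMatching.subgraphOfAdj h₂) ?_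
      simp [support_subgraphOfAdj]
    · simp only [Subgraph.edgeSet_sup, edgeSet_subgraphOfAdj, Set.singleton_union]
      apply Set.ncard_pair
      decide

theorem not_colorable_two_prismOverK4 : ¬ prismOverK4.Colorable 2 := by
  rintro ⟨c⟩
  have h₁ := c.valid (show prismOverK4.Adj 0 2 by decide)
  have h₂ := c.valid (show prismOverK4.Adj 0 4 by decide)
  have h₃ := c.valid (show prismOverK4.Adj 2 4 by decide)
  omega

theorem ncard_edgeSet_prismOverK4 : prismOverK4.edgeSet.ncard = 16 := by
  have hdeg : ∀ v, prismOverK4.degree v = 4 := by decide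
  have hsum := prismOverK4.sum_degrees_eq_twice_card_edges
  simp only [hdeg] at hsum
  rw [← coe_edgeFinset, Set.ncard_coe_finset]
  simp at hsum ⊢
  omega

theorem eps_eight_two :
    (∀ (V : Type) [Fintype V] (G : SimpleGraph V), Fintype.card V = 8 →
      IsExtendable G 2 → ¬ G.Colorable 2 → 16 ≤ G.edgeSet.ncard) ∧
    (∃ G : SimpleGraph (Fin 8), IsExtendable G 2 ∧ ¬ G.Colorable 2 ∧
      G.edgeSet.ncard = 16) := by
  exact ⟨fun V _ G hV hG hG2 => hG.sixteen_le_ncard_edgeSet hV hG2,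
    prismOverK4, isExtendable_prismOverK4, not_colorable_two_prismOverK4,
    ncard_edgeSet_prismOverK4⟩
end
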